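/- Fix an integer n ≥ 1. Let P^n(1) be the set of tuples (A₁, A₂; C₁, …, C_n; e) of complex numbers satisfying (P1), (P2), (P3) (the case c = 1), with the (ℂ*)² action (φ₁, φ₂): A_i ↦ φ₂A_iφ₁^{-1}, C_j ↦ φ₁C_jφ₂^{-1}, e ↦ eφ₁^{-1}. Let T̃_n = {((y₁, y₂), (u₁, u₂)) ∈ (ℂ² ∖ {0}) × ℂ² : u₁y₁ⁿ = u₂y₂ⁿ}, with the ℂ* action λ: (y₁, y₂) ↦ (λy₁, λy₂), (u₁, u₂) ↦ (u₁, u₂). Then there is a bijection between the orbit set P^n(1)/(ℂ*)² and the orbit set T̃_n/ℂ*. -/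

import Mathlib

/-- Condition (P1) in the scalar case c = 1 (C is 0-indexed: `C ⟨q⟩` is C_{q+1}). -/
def SP1 (n : ℕ) (A1 A2 : ℂ) (C : Fin n → ℂ) : Prop :=
  (∀ h : n = 1, A1 * C ⟨0, by omega⟩ * A2 = A2 * C ⟨0, by omega⟩ * A1) ∧
  ∀ q : ℕ, ∀ hq : q + 1 < n,
    A1 * C ⟨q, by omega⟩ = A2 * C ⟨q + 1, hq⟩ ∧
    C ⟨q, by omega⟩ * A1 = C ⟨q + 1, hq⟩ * A2

/-- Condition (P3) in the scalar case c = 1. -/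
def SP3 (n : ℕ) (A1 A2 C1 Cn e : ℂ) : Prop :=
  ∀ l1 l2 m1 m2 : ℂ, (l1, l2) ≠ 0 → l1 ^ n * m1 + l2 ^ n * m2 = 0 →
    ∀ v : ℂ,
      (l2 * A1 + l1 * A2) * v = 0 →
      (C1 * A2 + m1) * v = 0 →
      (Cn * A1 + (-1 : ℂ) ^ (n - 1) * m2) * v = 0 →
      e * v = 0 → v = 0

/-- Membership in `P^n(1)`: conditions (P1), (P2), (P3) in the scalar case. -/
def SPCond (n : ℕ) (hn : 0 < n) (t : ℂ × ℂ × (Fin n → ℂ) × ℂ) : Prop :=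
  SP1 n t.1 t.2.1 t.2.2.1 ∧ (t.1, t.2.1) ≠ 0 ∧
    SP3 n t.1 t.2.1 (t.2.2.1 ⟨0, hn⟩) (t.2.2.1 ⟨n - 1, by omega⟩) t.2.2.2

/-- Points of `P^n(1)`. -/
def PSub (n : ℕ) (hn : 0 < n) := {t : ℂ × ℂ × (Fin n → ℂ) × ℂ // SPCond n hn t}

/-- The orbit relation on `P^n(1)` for the (ℂ*)² action. -/
def relP (n : ℕ) (hn : 0 < n) : PSub n hn → PSub n hn → Prop := fun t t' =>
  ∃ φ1 φ2 : ℂ, φ1 ≠ 0 ∧ φ2 ≠ 0 ∧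
    t'.1.1 = φ2 * t.1.1 * φ1⁻¹ ∧
    t'.1.2.1 = φ2 * t.1.2.1 * φ1⁻¹ ∧
    (∀ j, t'.1.2.2.1 j = φ1 * t.1.2.2.1 j * φ2⁻¹) ∧
    t'.1.2.2.2 = t.1.2.2.2 * φ1⁻¹

/-- Points of `T̃_n = {((y₁,y₂),(u₁,u₂)) : (y₁,y₂) ≠ 0, u₁y₁ⁿ = u₂y₂ⁿ}`. -/
def TSub (n : ℕ) :=
  {p : (ℂ × ℂ) × ℂ × ℂ // p.1 ≠ 0 ∧ p.2.1 * p.1.1 ^ n = p.2.2 * p.1.2 ^ n}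

/-- The orbit relation on `T̃_n` for the ℂ* action. -/
def relT (n : ℕ) : TSub n → TSub n → Prop := fun p p' =>
  ∃ lam : ℂ, lam ≠ 0 ∧
    p'.1.1 = (lam * p.1.1.1, lam * p.1.1.2) ∧ p'.1.2 = p.1.2

theorem aux_k (n : ℕ) (hn : 0 < n) (A1 A2 : ℂ) (C : Fin n → ℂ) (hA : (A1, A2) ≠ (0 : ℂ × ℂ))
    (h : SP1 n A1 A2 C) : ∃ k : ℂ, ∀ j : Fin n, C j = k * A1 ^ (j : ℕ) * A2 ^ (n - 1 - (j : ℕ)) := by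
  by_cases h2 : A2 = 0
  · have h1 : A1 ≠ 0 := by
      rintro rfl; subst h2; exact hA rfl
    refine ⟨C ⟨n - 1, by omega⟩ / A1 ^ (n - 1), ?_⟩
    rintro ⟨j, hj⟩
    by_cases hjn : j = n - 1
    · subst hjn
      simp
      field_simp
    · have := (h.2 j (by omega)).1
      rw [h2, zero_mul] at this
      have hc := (mul_eq_zero.mp this).resolve_left h1
      rw [hc, h2, zero_pow (by simp; omega), mul_zero]
  · refine ⟨C ⟨0, hn⟩ / A2 ^ (n - 1), ?_⟩
    rintro ⟨j, hj⟩
    induction j with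
    | zero => simp; field_simp
    | succ j ih =>
      have e1 := (h.2 j hj).1
      rw [ih (by omega)] at e1
      apply mul_left_cancel₀ h2
      rw [← e1]
      have : n - 1 - j = (n - 1 - (j + 1)) + 1 := by omega
      simp only [this]
      ring

theorem aux_e (n : ℕ) (hn : 0 < n) (t : ℂ × ℂ × (Fin n → ℂ) × ℂ) (ht : SPCond n hn t) :
    t.2.2.2 ≠ 0 := by
  obtain ⟨A1, A2, C, e⟩ := t
  obtain ⟨h1, h2, h3⟩ := ht
  obtain ⟨k, hk⟩ := aux_k n hn A1 A2 C h2 h1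
  dsimp only at *
  rintro rfl
  obtain ⟨m, rfl⟩ : ∃ m, n = m + 1 := ⟨n - 1, by omega⟩
  have hs : ((-1 : ℂ) ^ m) * (-1) ^ m = 1 := by
    rw [← mul_pow]; simp
  have := h3 A1 (-A2) (-(C ⟨0, hn⟩ * A2)) (-((-1 : ℂ) ^ m * (C ⟨m, by omega⟩ * A1))) ?_ ?_ 1
    (by ring) (by ring) ?_ (by ring)
  · exact one_ne_zero this
  · intro h
    apply h2
    simpa using h
  · rw [hk, hk, neg_pow A2]
    simp only [Nat.add_sub_cancel, Nat.sub_self, Nat.sub_zero]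
    linear_combination (k * A1 ^ (m + 1) * A2 ^ (m + 1)) * hs
  · simp only [Nat.add_sub_cancel]
    linear_combination -(C ⟨m, by omega⟩ * A1) * hs

theorem aux_u (n : ℕ) (hn : 0 < n) (A1 A2 k : ℂ) (C : Fin n → ℂ)
    (hk : ∀ j : Fin n, C j = k * A1 ^ (j : ℕ) * A2 ^ (n - 1 - (j : ℕ))) :
    C ⟨0, hn⟩ * A2 = k * A2 ^ n ∧ C ⟨n - 1, by omega⟩ * A1 = k * A1 ^ n := by
  obtain ⟨m, rfl⟩ : ∃ m, n = m + 1 := ⟨n - 1, by omega⟩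
  rw [hk, hk]
  simp only [Nat.add_sub_cancel, Nat.sub_self, Nat.sub_zero]
  constructor <;> ring

theorem aux_equiv (n : ℕ) : Equivalence (relT n) := by
  refine ⟨fun p => ⟨1, one_ne_zero, by simp, rfl⟩, ?_, ?_⟩
  · rintro p q ⟨l, hl, h1, h2⟩
    refine ⟨l⁻¹, inv_ne_zero hl, ?_, h2.symm⟩
    rw [h1]; simp [hl]
  · rintro p q r ⟨l, hl, h1, h2⟩ ⟨l', hl', h1', h2'⟩
    refine ⟨l' * l, mul_ne_zero hl' hl, ?_, h2'.trans h2⟩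
    rw [h1', h1]; simp [mul_assoc]

/-- The map on points. -/
def auxMap (n : ℕ) (hn : 0 < n) (t : PSub n hn) : TSub n :=
  ⟨((t.1.1, t.1.2.1), (t.1.2.2.1 ⟨0, hn⟩ * t.1.2.1, t.1.2.2.1 ⟨n - 1, by omega⟩ * t.1.1)), by
    obtain ⟨k, hk⟩ := aux_k n hn _ _ _ t.2.2.1 t.2.1
    obtain ⟨h1, h2⟩ := aux_u n hn _ _ k _ hk
    refine ⟨t.2.2.1, ?_⟩
    dsimp only
    rw [h1, h2]; ring⟩

/-- there is a bijection between P^n(1)/(ℂ*)² and T̃_n/ℂ*. -/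
theorem stmt16 (n : ℕ) (hn : 0 < n) :
    ∃ f : Quot (relP n hn) → Quot (relT n), Function.Bijective f := by
  refine ⟨Quot.map (auxMap n hn) ?_, ?_, ?_⟩
  · rintro t t' ⟨a, b, ha, hb, h1, h2, h3, h4⟩
    refine ⟨b * a⁻¹, mul_ne_zero hb (inv_ne_zero ha), ?_, ?_⟩
    · simp only [auxMap, h1, h2]
      ext <;> simp <;> ring
    · simp only [auxMap, h1, h2, h3]
      ext <;> simp <;> field_simp
  · rintro ⟨t⟩ ⟨t'⟩ h
    have h' : relT n (auxMap n hn t) (auxMap n hn t') :=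
      (aux_equiv n).eqvGen_iff.mp (Quot.eqvGen_exact h)
    apply Quot.sound
    obtain ⟨l, hl, h1, h2⟩ := h'
    have he := aux_e n hn _ t.2
    have he' := aux_e n hn _ t'.2
    obtain ⟨k, hk⟩ := aux_k n hn _ _ _ t.2.2.1 t.2.1
    obtain ⟨k', hk'⟩ := aux_k n hn _ _ _ t'.2.2.1 t'.2.1
    obtain ⟨u1, u2⟩ := aux_u n hn _ _ k _ hk
    obtain ⟨u1', u2'⟩ := aux_u n hn _ _ k' _ hk'
    have hA := t.2.2.1
    simp only [auxMap, Prod.mk.injEq] at h1 h2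
    rw [u1, u1', u2, u2', h1.1, h1.2] at h2
    have hkk : k = k' * l ^ n := by
      by_cases hz : t.1.1 = 0
      · have hz2 : t.1.2.1 ≠ 0 := fun hz2 => hA (by rw [hz, hz2]; rfl)
        apply mul_right_cancel₀ (pow_ne_zero n hz2)
        rw [← h2.1]; ring
      · apply mul_right_cancel₀ (pow_ne_zero n hz)
        rw [← h2.2]; ring
    refine ⟨t.1.2.2.2 / t'.1.2.2.2, l * (t.1.2.2.2 / t'.1.2.2.2), div_ne_zero he he',
      mul_ne_zero hl (div_ne_zero he he'), ?_, ?_, ?_, ?_⟩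
    · rw [h1.1]; field_simp
    · rw [h1.2]; field_simp
    · intro j
      have e1 : t.1.2.2.1 j = l * t'.1.2.2.1 j := by
        rw [hk, hk', hkk, h1.1, h1.2, mul_pow, mul_pow]
        have : l ^ n = l * l ^ (j : ℕ) * l ^ (n - 1 - (j : ℕ)) := by
          rw [← pow_succ', ← pow_add]; congr 1; omega
        rw [this]; ring
      rw [e1]; field_simp
    · field_simp
  · rintro ⟨⟨⟨⟨y1, y2⟩, u1, u2⟩, hy, hu⟩⟩
    dsimp only at hy hu
    obtain ⟨k, hk1, hk2⟩ : ∃ k, u1 = k * y2 ^ n ∧ u2 = k * y1 ^ n := by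
      by_cases hz : y2 = 0
      · have h1 : y1 ≠ 0 := by
          rintro rfl; subst hz; exact hy rfl
        refine ⟨u2 / y1 ^ n, ?_, by field_simp⟩
        rw [hz, zero_pow hn.ne', mul_zero] at hu
        rw [hz, zero_pow hn.ne', mul_zero]
        exact (mul_eq_zero.mp hu).resolve_right (pow_ne_zero n h1)
      · refine ⟨u1 / y2 ^ n, by field_simp, ?_⟩
        field_simp
        exact hu.symm
    let C : Fin n → ℂ := fun j => k * y1 ^ (j : ℕ) * y2 ^ (n - 1 - (j : ℕ))
    have hC : ∀ q : ℕ, ∀ hq : q + 1 < n, y1 * C ⟨q, by omega⟩ = y2 * C ⟨q + 1, hq⟩ := by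
      intro q hq
      have : n - 1 - q = (n - 1 - (q + 1)) + 1 := by omega
      simp only [C, this]
      ring
    obtain ⟨v1, v2⟩ := aux_u n hn y1 y2 k C (fun j => rfl)
    refine ⟨Quot.mk _ ⟨(y1, y2, C, 1), ⟨fun _ => by ring, fun q hq => ⟨hC q hq, ?_⟩⟩, hy, ?_⟩, ?_⟩
    · have := hC q hq
      dsimp only
      linear_combination this
    · intro _ _ _ _ _ _ v _ _ _ h
      simpa using h
    · apply congrArg (Quot.mk (relT n))
      apply Subtype.ext
      simp only [auxMap]
      rw [v1, v2, hk1, hk2]
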